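/- arXiv:2312.01647 — 2 statements merged into one kernel-verified Lean document; each statement's English description precedes it below -/
import Mathlib

section
/- Let S and T be finite sets of positive integers with T ⪯ S and |T| > |S|. Then there is a smallest element y ∈ T such that T − y ⪯ S, and the following hold: (i) for every index j with T(j) < y one has (T ◁ S)(j) = T(j) (all such j satisfy j ≤ |S| = |T ◁ S|, so the index is valid); (ii) y ∉ T ◁ S; (iii) for every subset S' ⊆ S, (T − y) ◁ S' = T ◁ S'. -/
/-- The `◁` operator: `tri T S = T ◁ S`.  Iterate through the elements of `S` from
largest to smallest; the current element `s` picks the largest element of `T` that is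
less than `s` and has not yet been picked (if such an element exists), and the picked
elements form `T ◁ S`. -/
def tri (T S : Finset ℕ) : Finset ℕ :=
  if hS : S.Nonempty then
    if hT : (T.filter (fun t => t < S.max' hS)).Nonempty then
      insert ((T.filter (fun t => t < S.max' hS)).max' hT)
        (tri (T.filter (fun t => t < (T.filter (fun t => t < S.max' hS)).max' hT))
          (S.erase (S.max' hS)))
    else ∅
  else ∅
termination_by S.card
decreasing_by
  exact Finset.card_erase_lt_of_mem (S.max'_mem hS)

/-- `nth S i` is the `i`-th smallest element of `S` (1-based), i.e. `S(i)`. -/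
def nth (S : Finset ℕ) (i : ℕ) : ℕ :=
  (S.sort (· ≤ ·)).getD (i - 1) 0

/-- `Dom T S` means `T ⪯ S`, i.e. `S` dominates `T`:
`|T| ≥ |S|` and `T(i) < S(i)` for all `1 ≤ i ≤ |S|`. -/
def Dom (T S : Finset ℕ) : Prop :=
  S.card ≤ T.card ∧ ∀ i, 1 ≤ i → i ≤ S.card → nth T i < nth S i

open Finset in
theorem nth_spec (S : Finset ℕ) (j : ℕ) (h1 : 1 ≤ j) (h2 : j ≤ S.card) :
    nth S j ∈ S ∧ (S.filter (fun t => t < nth S j)).card = j - 1 := by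
  have hlt : j - 1 < S.card := by omega
  have e : nth S j = S.orderEmbOfFin rfl ⟨j - 1, hlt⟩ := by
    rw [Finset.orderEmbOfFin_apply]
    unfold nth
    rw [List.getD_eq_getElem _ _ (by rw [Finset.length_sort]; exact hlt)]
    rfl
  refine ⟨e ▸ Finset.orderEmbOfFin_mem _ _ _, ?_⟩
  have : S.filter (fun t => t < nth S j)
      = (Finset.Iio (⟨j - 1, hlt⟩ : Fin S.card)).map (S.orderEmbOfFin rfl).toEmbedding := by
    ext x
    simp only [mem_filter, mem_map, mem_Iio, e]
    constructor
    · rintro ⟨hx, hxl⟩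
      have : x ∈ Set.range (S.orderEmbOfFin rfl) := by
        rw [Finset.range_orderEmbOfFin]; exact hx
      obtain ⟨i, rfl⟩ := this
      exact ⟨i, by simpa using hxl, rfl⟩
    · rintro ⟨i, hi, rfl⟩
      exact ⟨Finset.orderEmbOfFin_mem _ _ _, by simpa using hi⟩
  rw [this, card_map, Fin.card_Iio]

theorem card_le_eq (S : Finset ℕ) (x : ℕ) (hx : x ∈ S) :
    (S.filter (fun t => t ≤ x)).card = (S.filter (fun t => t < x)).card + 1 := by
  have : S.filter (fun t => t ≤ x) = insert x (S.filter (fun t => t < x)) := by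
    ext a; simp only [Finset.mem_filter, Finset.mem_insert]; grind
  rw [this, Finset.card_insert_of_notMem (by simp)]

theorem card_lt_mono (S : Finset ℕ) (x y : ℕ) (h : x ≤ y) :
    (S.filter (fun t => t < x)).card ≤ (S.filter (fun t => t < y)).card := by
  apply Finset.card_le_card
  intro a; simp only [Finset.mem_filter]; grind

theorem card_le_lt (S : Finset ℕ) (x y : ℕ) (h : x < y) :
    (S.filter (fun t => t ≤ x)).card ≤ (S.filter (fun t => t < y)).card := by
  apply Finset.card_le_card
  intro a; simp only [Finset.mem_filter]; grind

theorem nth_unique (S : Finset ℕ) (j x : ℕ) (h1 : 1 ≤ j) (hx : x ∈ S)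
    (h : (S.filter (fun t => t < x)).card = j - 1) : nth S j = x := by
  have h2 : j ≤ S.card := by
    have := card_le_eq S x hx
    have := Finset.card_filter_le S (fun t => t ≤ x)
    omega
  obtain ⟨hm, hc⟩ := nth_spec S j h1 h2
  rcases lt_trichotomy (nth S j) x with hl | hl | hl
  · have := card_le_eq S _ hm
    have := card_le_lt S _ _ hl
    omega
  · exact hl
  · have := card_le_eq S _ hx
    have := card_le_lt S _ _ hl
    omega

theorem dom_iff (T S : Finset ℕ) : Dom T S ↔
    ∀ s ∈ S, (S.filter (fun t => t ≤ s)).card ≤ (T.filter (fun t => t < s)).card := by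
  constructor
  · rintro ⟨hc, h⟩ s hs
    have e := card_le_eq S s hs
    have hle := Finset.card_filter_le S (fun t => t ≤ s)
    set i := (S.filter (fun t => t ≤ s)).card with hi
    have hn := nth_unique S i s (by omega) hs (by omega)
    have hl := h i (by omega) hle
    rw [hn] at hl
    obtain ⟨hm, hc'⟩ := nth_spec T i (by omega) (by omega)
    have := card_le_eq T _ hm
    have := card_le_lt T _ _ hl
    omega
  · intro h
    have hc : S.card ≤ T.card := by
      rcases S.eq_empty_or_nonempty with rfl | hS
      · simp
      · have := h _ (S.max'_mem hS)
        rw [Finset.filter_true_of_mem (fun x hx => S.le_max' x hx)] at this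
        exact this.trans (Finset.card_filter_le _ _)
    refine ⟨hc, fun i h1 h2 => ?_⟩
    obtain ⟨hm, hc1⟩ := nth_spec S i h1 h2
    obtain ⟨hm', hc2⟩ := nth_spec T i h1 (by omega)
    by_contra hlt
    have := h _ hm
    have := card_le_eq S _ hm
    have := card_lt_mono T _ _ (not_lt.1 hlt)
    omega

/-- Induction principle for `tri`. -/
theorem tri_cases (T S : Finset ℕ) :
    (S = ∅ ∧ tri T S = ∅) ∨
    (∃ s ∈ S, (∀ a ∈ S, a ≤ s) ∧ (∀ a ∈ T, ¬ a < s) ∧ tri T S = ∅) ∨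
    (∃ s ∈ S, (∀ a ∈ S, a ≤ s) ∧ ∃ t ∈ T, t < s ∧ (∀ a ∈ T, a < s → a ≤ t) ∧
      tri T S = insert t (tri (T.filter (fun a => a < t)) (S.erase s))) := by
  rw [tri]
  by_cases hS : S.Nonempty
  · right
    simp only [hS, dite_true]
    by_cases hT : (T.filter (fun t => t < S.max' hS)).Nonempty
    · right
      simp only [hT, dite_true]
      have hm := Finset.max'_mem _ hT
      rw [Finset.mem_filter] at hm
      refine ⟨_, S.max'_mem hS, fun a ha => S.le_max' a ha, _, hm.1, hm.2, ?_, rfl⟩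
      intro a ha hl
      exact Finset.le_max' _ _ (Finset.mem_filter.2 ⟨ha, hl⟩)
    · left
      simp only [hT, dite_false]
      refine ⟨_, S.max'_mem hS, fun a ha => S.le_max' a ha, ?_, trivial⟩
      intro a ha hl
      exact hT ⟨a, Finset.mem_filter.2 ⟨ha, hl⟩⟩
  · left
    simp only [hS, dite_false]
    exact ⟨Finset.not_nonempty_iff_eq_empty.1 hS, trivial⟩

theorem tri_eq (T S : Finset ℕ) (s t : ℕ) (hs : s ∈ S) (hmax : ∀ a ∈ S, a ≤ s)
    (ht : t ∈ T) (hts : t < s) (htm : ∀ a ∈ T, a < s → a ≤ t) :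
    tri T S = insert t (tri (T.filter (fun a => a < t)) (S.erase s)) := by
  rcases tri_cases T S with ⟨h, _⟩ | ⟨s', hs', hm', hn, _⟩ | ⟨s', hs', hm', t', ht', hl', htm', h⟩
  · subst h; simp at hs
  · exact absurd hts (by have := hm' s hs; have := hn t ht; omega)
  · obtain rfl : s = s' := le_antisymm (hm' _ hs) (hmax _ hs')
    obtain rfl : t = t' := le_antisymm (htm' _ ht hts) (htm _ ht' hl')
    exact h

theorem tri_none (T S : Finset ℕ) (s : ℕ) (hs : s ∈ S) (hmax : ∀ a ∈ S, a ≤ s)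
    (hn : ∀ a ∈ T, ¬ a < s) : tri T S = ∅ := by
  rcases tri_cases T S with ⟨h, h'⟩ | ⟨s', hs', hm', hn, h⟩ | ⟨s', hs', hm', t', ht', hl', htm', h⟩
  · exact h'
  · exact h
  · exact absurd hl' (by have := hmax _ hs'; have := hn t' ht'; omega)

theorem tri_sub (n : ℕ) : ∀ T S : Finset ℕ, S.card = n → tri T S ⊆ T := by
  induction n with
  | zero =>
    intro T S h
    rcases tri_cases T S with ⟨_, h'⟩ | ⟨s', hs', _, _, h'⟩ | ⟨s', hs', _⟩
    · simp [h']
    · simp [h']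
    · rw [Finset.card_eq_zero] at h; simp [h] at hs'
  | succ n ih =>
    intro T S h
    rcases tri_cases T S with ⟨_, h'⟩ | ⟨s', hs', _, _, h'⟩ | ⟨s, hs, hm, t, ht, hl, htm, h'⟩
    · simp [h']
    · simp [h']
    · rw [h']
      have := ih (T.filter (fun a => a < t)) (S.erase s) (by rw [Finset.card_erase_of_mem hs]; omega)
      intro x hx
      rcases Finset.mem_insert.1 hx with rfl | hx
      · exact ht
      · exact (Finset.mem_filter.1 (this hx)).1

theorem tri_lt (T S : Finset ℕ) (s : ℕ) (hm : ∀ a ∈ S, a ≤ s) : ∀ x ∈ tri T S, x < s := by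
  rcases tri_cases T S with ⟨_, h'⟩ | ⟨s', hs', _, _, h'⟩ | ⟨s', hs, _, t, ht, hl, htm, h'⟩
  · simp [h']
  · simp [h']
  · intro x hx
    have := hm _ hs
    rw [h'] at hx
    rcases Finset.mem_insert.1 hx with rfl | hx
    · omega
    · have := (Finset.mem_filter.1 (tri_sub _ _ _ rfl hx)).2
      omega

theorem tri_count (y n : ℕ) : ∀ T S : Finset ℕ, S.card = n →
    ((tri T S).filter (fun t => y ≤ t)).card ≤ (S.filter (fun t => y < t)).card := by
  induction n with
  | zero =>
    intro T S h
    rcases tri_cases T S with ⟨_, h'⟩ | ⟨s', hs', _, _, h'⟩ | ⟨s', hs', _⟩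
    · simp [h']
    · simp [h']
    · rw [Finset.card_eq_zero] at h; simp [h] at hs'
  | succ n ih =>
    intro T S h
    rcases tri_cases T S with ⟨_, h'⟩ | ⟨s', hs', _, _, h'⟩ | ⟨s, hs, hm, t, ht, hl, htm, h'⟩
    · simp [h']
    · simp [h']
    · rw [h']
      have := ih (T.filter (fun a => a < t)) (S.erase s) (by rw [Finset.card_erase_of_mem hs]; omega)
      rw [Finset.filter_insert]
      have hle : ((S.erase s).filter (fun t => y < t)).card ≤ (S.filter (fun t => y < t)).card :=
        Finset.card_le_card (Finset.filter_subset_filter _ (Finset.erase_subset _ _))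
      split_ifs with hy
      · refine (Finset.card_insert_le _ _).trans ?_
        rw [Finset.filter_erase, Finset.card_erase_of_mem (Finset.mem_filter.2 ⟨hs, by omega⟩)] at this
        have : 0 < (S.filter (fun t => y < t)).card :=
          Finset.card_pos.2 ⟨s, Finset.mem_filter.2 ⟨hs, by omega⟩⟩
        omega
      · omega

theorem tri_card (n : ℕ) : ∀ T S : Finset ℕ, S.card = n →
    (∀ s ∈ S, (S.filter (fun t => t ≤ s)).card ≤ (T.filter (fun t => t < s)).card) →
    (tri T S).card = n := by
  induction n with
  | zero =>
    intro T S h _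
    rcases tri_cases T S with ⟨_, h'⟩ | ⟨s', hs', _, _, h'⟩ | ⟨s', hs', _⟩
    · simp [h']
    · simp [h']
    · rw [Finset.card_eq_zero] at h; simp [h] at hs'
  | succ n ih =>
    intro T S h hd
    rcases tri_cases T S with ⟨h', _⟩ | ⟨s, hs, _, hn, h'⟩ | ⟨s, hs, hm, t, ht, hl, htm, h'⟩
    · simp [h'] at h
    · have h1 := hd s hs
      rw [Finset.filter_false_of_mem hn, card_le_eq S s hs] at h1
      simp at h1
    · rw [h', Finset.card_insert_of_notMem, ih _ _ (by rw [Finset.card_erase_of_mem hs]; omega)]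
      · intro s' hs'
        obtain ⟨hne, hs'S⟩ := Finset.mem_erase.1 hs'
        have hlt : s' < s := lt_of_le_of_ne (hm _ hs'S) hne
        have h1 := hd s hs
        have h2 := hd s' hs'S
        have h3 := card_le_eq S s hs
        have h4 := card_le_lt S _ _ hlt
        have h5 := card_le_eq T t ht
        have h6 : T.filter (fun a => a < s) = T.filter (fun a => a ≤ t) := by
          ext a; simp only [Finset.mem_filter]; grind
        have h7 : ((S.erase s).filter (fun t => t ≤ s')).card ≤ (S.filter (fun t => t ≤ s')).card :=
          Finset.card_le_card (Finset.filter_subset_filter _ (Finset.erase_subset _ _))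
        rw [h6] at h1
        rw [Finset.filter_filter]
        by_cases hst : s' ≤ t
        · have : T.filter (fun a => a < t ∧ a < s') = T.filter (fun a => a < s') := by
            ext a; simp only [Finset.mem_filter]; grind
          rw [this]; omega
        · have : T.filter (fun a => a < t ∧ a < s') = T.filter (fun a => a < t) := by
            ext a; simp only [Finset.mem_filter]; grind
          rw [this]; omega
      · intro hx
        have := (Finset.mem_filter.1 (tri_sub _ _ _ rfl hx)).2
        omega

theorem tri_erase (y n : ℕ) : ∀ T S : Finset ℕ, S.card = n →
    (∀ s ∈ S, y < s → (S.filter (fun t => y < t ∧ t ≤ s)).card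
      ≤ (T.filter (fun t => y < t ∧ t < s)).card) →
    y ∉ tri T S ∧ tri (T.erase y) S = tri T S := by
  induction n with
  | zero =>
    intro T S h _
    obtain rfl := Finset.card_eq_zero.1 h
    rw [tri, tri]; simp
  | succ n ih =>
    intro T S h hd
    rcases tri_cases T S with ⟨h', _⟩ | ⟨s, hs, hm, hn, h'⟩ | ⟨s, hs, hm, t, ht, hl, htm, h'⟩
    · simp [h'] at h
    · rw [h']
      refine ⟨by simp, tri_none _ _ s hs hm fun a ha => hn a (Finset.mem_of_mem_erase ha)⟩
    · by_cases hys : s ≤ y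
      · refine ⟨fun hy => ?_, ?_⟩
        · have := tri_lt T S s hm y hy
          omega
        · rw [h', tri_eq (T.erase y) S s t hs hm (Finset.mem_erase.2 ⟨by omega, ht⟩) hl
            (fun a ha => htm a (Finset.mem_of_mem_erase ha))]
          congr 2
          ext a; simp only [Finset.mem_filter, Finset.mem_erase]; grind
      · have h1 := hd s hs (by omega)
        have hyt : y < t := by
          have : 0 < (S.filter (fun t => y < t ∧ t ≤ s)).card :=
            Finset.card_pos.2 ⟨s, Finset.mem_filter.2 ⟨hs, by omega, le_rfl⟩⟩
          obtain ⟨a, ha⟩ := Finset.card_pos.1 (this.trans_le h1)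
          obtain ⟨haT, h2, h3⟩ := Finset.mem_filter.1 ha
          have := htm a haT h3
          omega
        have key := ih (T.filter (fun a => a < t)) (S.erase s)
          (by rw [Finset.card_erase_of_mem hs]; omega) (by
          intro s' hs' hys'
          obtain ⟨hne, hs'S⟩ := Finset.mem_erase.1 hs'
          have hlt : s' < s := lt_of_le_of_ne (hm _ hs'S) hne
          have h2 := hd s' hs'S hys'
          have h7 : ((S.erase s).filter (fun t => y < t ∧ t ≤ s')).card
              ≤ (S.filter (fun t => y < t ∧ t ≤ s')).card :=
            Finset.card_le_card (Finset.filter_subset_filter _ (Finset.erase_subset _ _))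
          rw [Finset.filter_filter]
          by_cases hst : s' ≤ t
          · have : T.filter (fun a => a < t ∧ y < a ∧ a < s')
                = T.filter (fun a => y < a ∧ a < s') := by
              ext a; simp only [Finset.mem_filter]; grind
            rw [this]; omega
          · have e1 : T.filter (fun a => y < a ∧ a < s)
                = insert t (T.filter (fun a => a < t ∧ y < a ∧ a < s')) := by
              ext a; simp only [Finset.mem_filter, Finset.mem_insert]; grind
            have e2 : insert s (S.filter (fun a => y < a ∧ a ≤ s'))
                ⊆ S.filter (fun a => y < a ∧ a ≤ s) := by
              intro a; simp only [Finset.mem_filter, Finset.mem_insert]; grind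
            have e3 := Finset.card_le_card e2
            rw [Finset.card_insert_of_notMem (by simp; omega)] at e3
            rw [e1, Finset.card_insert_of_notMem (by simp)] at h1
            omega)
        rw [h', tri_eq (T.erase y) S s t hs hm (Finset.mem_erase.2 ⟨by omega, ht⟩) hl
            (fun a ha => htm a (Finset.mem_of_mem_erase ha)), Finset.filter_erase, key.2]
        refine ⟨?_, rfl⟩
        rw [Finset.mem_insert]
        rintro (h | h)
        · omega
        · exact key.1 h

theorem dom_erase (T S : Finset ℕ) (y : ℕ) (hy : y ∈ T) (hd : Dom T S) :
    Dom (T.erase y) S ↔ ∀ s ∈ S, y < s →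
      (S.filter (fun t => t ≤ s)).card < (T.filter (fun t => t < s)).card := by
  rw [dom_iff] at hd ⊢
  refine forall₂_congr fun s hs => ?_
  rw [Finset.filter_erase]
  by_cases h : y < s
  · have hm : y ∈ T.filter (fun t => t < s) := Finset.mem_filter.2 ⟨hy, h⟩
    have := Finset.card_pos.2 ⟨y, hm⟩
    rw [Finset.card_erase_of_mem hm]
    simp only [h, true_imp_iff]
    omega
  · rw [Finset.erase_eq_of_notMem (by simp [h])]
    simp only [h, false_imp_iff, iff_true]
    exact hd s hs

theorem stmt13 (S T : Finset ℕ) (hSpos : ∀ a ∈ S, 0 < a) (hTpos : ∀ a ∈ T, 0 < a)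
    (hd : Dom T S) (hc : S.card < T.card) :
    ∃ y ∈ T, Dom (T.erase y) S ∧
      (∀ y' ∈ T, Dom (T.erase y') S → y ≤ y') ∧
      (∀ j, 1 ≤ j → j ≤ T.card → nth T j < y → nth (tri T S) j = nth T j) ∧
      y ∉ tri T S ∧
      (∀ S' ⊆ S, tri (T.erase y) S' = tri T S') := by
  classical
  have hTne : T.Nonempty := Finset.card_pos.1 (by omega)
  have hex : ∃ y, y ∈ T ∧ Dom (T.erase y) S := by
    refine ⟨_, T.max'_mem hTne, (dom_erase _ _ _ (T.max'_mem hTne) hd).2 fun s hs hl => ?_⟩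
    rw [Finset.filter_true_of_mem (s := T) (fun x hx => (T.le_max' x hx).trans_lt hl)]
    exact (Finset.card_filter_le _ _).trans_lt hc
  obtain ⟨hyT, hyD⟩ := Nat.find_spec hex
  have hmin : ∀ y' ∈ T, Dom (T.erase y') S → Nat.find hex ≤ y' :=
    fun y' h1 h2 => Nat.find_min' hex ⟨h1, h2⟩
  generalize Nat.find hex = y at hyT hyD hmin
  have hyD' := (dom_erase T S y hyT hd).1 hyD
  have hd' := (dom_iff T S).1 hd
  -- the key equality
  have hge : (T.filter (fun t => t < y)).card ≤ (S.filter (fun t => t ≤ y)).card := by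
    rcases (T.filter (fun t => t < y)).eq_empty_or_nonempty with he | hne
    · simp [he]
    · have hm := Finset.max'_mem _ hne
      have hmx : ∀ a ∈ T, a < y → a ≤ (T.filter (fun t => t < y)).max' hne :=
        fun a h1 h2 => Finset.le_max' _ _ (Finset.mem_filter.2 ⟨h1, h2⟩)
      generalize (T.filter (fun t => t < y)).max' hne = p at hm hmx
      obtain ⟨hpT, hpy⟩ := Finset.mem_filter.1 hm
      have hnd : ¬ Dom (T.erase p) S := fun h => by have := hmin p hpT h; omega
      rw [dom_erase T S p hpT hd] at hnd
      push Not at hnd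
      obtain ⟨s, hs, hps, hle⟩ := hnd
      have hsy : s ≤ y := by
        by_contra hsy
        have := hyD' s hs (by omega)
        omega
      have e1 : T.filter (fun t => t < y) ⊆ T.filter (fun t => t < s) := by
        intro a; simp only [Finset.mem_filter]; grind
      have e2 : S.filter (fun t => t ≤ s) ⊆ S.filter (fun t => t ≤ y) := by
        intro a; simp only [Finset.mem_filter]; grind
      exact (Finset.card_le_card e1).trans (hle.trans (Finset.card_le_card e2))
  have hle : (S.filter (fun t => t ≤ y)).card ≤ (T.filter (fun t => t < y)).card := by
    rcases (S.filter (fun t => t ≤ y)).eq_empty_or_nonempty with he | hne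
    · simp [he]
    · have hm := Finset.max'_mem _ hne
      have hmx : ∀ a ∈ S, a ≤ y → a ≤ (S.filter (fun t => t ≤ y)).max' hne :=
        fun a h1 h2 => Finset.le_max' _ _ (Finset.mem_filter.2 ⟨h1, h2⟩)
      generalize (S.filter (fun t => t ≤ y)).max' hne = p at hm hmx
      obtain ⟨hpS, hpy⟩ := Finset.mem_filter.1 hm
      have e1 : S.filter (fun t => t ≤ y) ⊆ S.filter (fun t => t ≤ p) := by
        intro a; simp only [Finset.mem_filter]; grind
      exact (Finset.card_le_card e1).trans ((hd' p hpS).trans (card_lt_mono T p y hpy))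
  have hcond : ∀ s ∈ S, y < s → (S.filter (fun t => y < t ∧ t ≤ s)).card
      ≤ (T.filter (fun t => y < t ∧ t < s)).card := by
    intro s hs hys
    have h1 := hyD' s hs hys
    have e1 : S.filter (fun t => t ≤ s)
        = S.filter (fun t => t ≤ y) ∪ S.filter (fun t => y < t ∧ t ≤ s) := by
      ext a; simp only [Finset.mem_filter, Finset.mem_union]; grind
    have e2 : T.filter (fun t => t < s)
        = T.filter (fun t => t ≤ y) ∪ T.filter (fun t => y < t ∧ t < s) := by
      ext a; simp only [Finset.mem_filter, Finset.mem_union]; grind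
    have d1 : Disjoint (S.filter (fun t => t ≤ y)) (S.filter (fun t => y < t ∧ t ≤ s)) := by
      rw [Finset.disjoint_left]; intro a; simp only [Finset.mem_filter]; grind
    have e3 := card_le_eq T y hyT
    have e4 := Finset.card_union_le (T.filter (fun t => t ≤ y)) (T.filter (fun t => y < t ∧ t < s))
    rw [e1, Finset.card_union_of_disjoint d1, e2] at h1
    omega
  have hsub : ∀ S' ⊆ S, y ∉ tri T S' ∧ tri (T.erase y) S' = tri T S' := by
    intro S' hS'
    refine tri_erase y _ T S' rfl fun s hs hys => ?_
    exact (Finset.card_le_card (Finset.filter_subset_filter _ hS')).trans (hcond s (hS' hs) hys)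
  have hfil : (tri T S).filter (fun t => t < y) = T.filter (fun t => t < y) := by
    apply Finset.eq_of_subset_of_card_le
    · exact Finset.filter_subset_filter _ (tri_sub _ T S rfl)
    · have h1 := tri_card _ T S rfl hd'
      have h2 := tri_count y _ T S rfl
      have h3 := Finset.card_filter_add_card_filter_not (s := tri T S) (fun t => t < y)
      have h4 := Finset.card_filter_add_card_filter_not (s := S) (fun t => t ≤ y)
      simp only [not_lt, not_le] at h3 h4
      omega
  refine ⟨y, hyT, hyD, hmin, ?_, (hsub S subset_rfl).1, fun S' h => (hsub S' h).2⟩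
  intro j h1 h2 hl
  obtain ⟨hm, hcj⟩ := nth_spec T j h1 h2
  have hmf : nth T j ∈ (tri T S).filter (fun t => t < y) := by
    rw [hfil]; exact Finset.mem_filter.2 ⟨hm, hl⟩
  apply nth_unique _ _ _ h1 (Finset.mem_filter.1 hmf).1
  rw [← hcj]
  congr 1
  ext a
  have : a ∈ (tri T S).filter (fun t => t < y) ↔ a ∈ T.filter (fun t => t < y) := by rw [hfil]
  simp only [Finset.mem_filter] at this ⊢
  grind
end

section
/- Let U and T be finite sets of positive integers. Suppose there is a positive integer x ∉ T such that U_{≥x} ⪯ T_{>x} and |U_{<x}| ≤ |T_{<x}|; set δ = |T_{<x}| − |U_{<x}| and suppose that U(i) < T(i + δ) for every 1 ≤ i ≤ |U_{<x}|. Then for every finite set S of positive integers, U ◁ (T ◁ S) = U ◁ ((T ⊔ x) ◁ S). -/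
theorem nth_spec_s15 (A : Finset ℕ) (i : ℕ) (h1 : 1 ≤ i) (h2 : i ≤ A.card) :
    nth A i ∈ A ∧ (A.filter (· < nth A i)).card = i - 1 := by
  have hlt : i - 1 < A.card := by omega
  have e : nth A i = A.orderEmbOfFin rfl ⟨i - 1, hlt⟩ := by
    rw [Finset.orderEmbOfFin_apply]
    unfold nth
    rw [List.getD_eq_getElem _ _ (by rw [Finset.length_sort]; exact hlt)]
    rfl
  refine ⟨?_, ?_⟩
  · rw [e]; exact Finset.orderEmbOfFin_mem _ _ _
  · have : A.filter (· < nth A i)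
        = (Finset.Iio (⟨i - 1, hlt⟩ : Fin A.card)).map (A.orderEmbOfFin rfl).toEmbedding := by
      ext a
      simp only [Finset.mem_filter, Finset.mem_map, Finset.mem_Iio]
      constructor
      · rintro ⟨ha, hb⟩
        have : a ∈ Set.range (A.orderEmbOfFin rfl) := by
          rw [Finset.range_orderEmbOfFin]; exact ha
        obtain ⟨j, rfl⟩ := this
        rw [e] at hb
        exact ⟨j, (A.orderEmbOfFin rfl).lt_iff_lt.1 hb, rfl⟩
      · rintro ⟨j, hj, rfl⟩
        refine ⟨Finset.orderEmbOfFin_mem _ _ _, ?_⟩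
        rw [e]
        exact (A.orderEmbOfFin rfl).lt_iff_lt.2 hj
    rw [this, Finset.card_map, Fin.card_Iio]

/-- number of elements of `A` in `[p, q)` -/
def seg (A : Finset ℕ) (p q : ℕ) : ℕ := (A.filter (fun a => p ≤ a ∧ a < q)).card

/-- number of elements of `A` in `[p, ∞)` -/
def up (A : Finset ℕ) (p : ℕ) : ℕ := (A.filter (fun a => p ≤ a)).card

theorem seg_add (A : Finset ℕ) (p q r : ℕ) (h1 : p ≤ q) (h2 : q ≤ r) :
    seg A p r = seg A p q + seg A q r := by
  unfold seg
  rw [← Finset.card_union_of_disjoint]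
  · congr 1; ext a; simp only [Finset.mem_union, Finset.mem_filter]
    constructor
    · rintro ⟨h, h', h''⟩
      by_cases a < q
      · left; exact ⟨h, by omega, by omega⟩
      · right; exact ⟨h, by omega, by omega⟩
    · rintro (⟨h, h', h''⟩ | ⟨h, h', h''⟩) <;> exact ⟨h, by omega, by omega⟩
  · rw [Finset.disjoint_left]; intro a; simp only [Finset.mem_filter]; omega

theorem up_add (A : Finset ℕ) (p q : ℕ) (h1 : p ≤ q) :
    up A p = seg A p q + up A q := by
  unfold seg up
  rw [← Finset.card_union_of_disjoint]
  · congr 1; ext a; simp only [Finset.mem_union, Finset.mem_filter]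
    constructor
    · rintro ⟨h, h'⟩
      by_cases a < q
      · left; exact ⟨h, by omega, by omega⟩
      · right; exact ⟨h, by omega⟩
    · rintro (⟨h, h', h''⟩ | ⟨h, h'⟩) <;> exact ⟨h, by omega⟩
  · rw [Finset.disjoint_left]; intro a; simp only [Finset.mem_filter]; omega

theorem seg_mono {A B : Finset ℕ} (h : A ⊆ B) (p q : ℕ) : seg A p q ≤ seg B p q :=
  Finset.card_le_card (Finset.filter_subset_filter _ h)

theorem seg_insert_of (A : Finset ℕ) (x p q : ℕ) (h : x < p ∨ q ≤ x) :
    seg (insert x A) p q = seg A p q := by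
  unfold seg; rw [Finset.filter_insert, if_neg (by omega)]

theorem up_insert_le (A : Finset ℕ) (m p : ℕ) :
    up (insert m A) p ≤ up A p + (if p ≤ m then 1 else 0) := by
  unfold up; rw [Finset.filter_insert]
  split_ifs
  · exact Finset.card_insert_le _ _
  · exact le_rfl

theorem up_erase (A : Finset ℕ) (s p : ℕ) (hs : s ∈ A) :
    up A p = up (A.erase s) p + (if p ≤ s then 1 else 0) := by
  conv_lhs => rw [← Finset.insert_erase hs]
  unfold up; rw [Finset.filter_insert]
  split_ifs
  · rw [Finset.card_insert_of_notMem]; simp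
  · rfl

theorem up_eq_zero (A : Finset ℕ) (p : ℕ) (h : ∀ a ∈ A, a < p) : up A p = 0 := by
  unfold up; rw [Finset.card_eq_zero, Finset.filter_eq_empty_iff]
  intro a ha; have := h a ha; omega

theorem seg_eq_zero (A : Finset ℕ) (p q : ℕ) (h : ∀ a ∈ A, p ≤ a → a < q → False) :
    seg A p q = 0 := by
  unfold seg; rw [Finset.card_eq_zero, Finset.filter_eq_empty_iff]
  intro a ha hh; exact h a ha hh.1 hh.2

theorem eq_of_up {A B : Finset ℕ} (h : ∀ p, up A p = up B p) : A = B := by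
  have key : ∀ (C : Finset ℕ) a, a ∈ C ↔ up C a ≠ up C (a + 1) := by
    intro C a
    have h1 := up_add C a (a + 1) (by omega)
    have : seg C a (a + 1) ≠ 0 ↔ a ∈ C := by
      unfold seg
      rw [Finset.card_ne_zero]
      constructor
      · rintro ⟨b, hb⟩
        simp only [Finset.mem_filter] at hb
        have : b = a := by omega
        rw [← this]; exact hb.1
      · intro h; exact ⟨a, by simp [h]⟩
    rw [← this]; omega
  ext a; rw [key, key, h, h]

theorem tri_subset (T S : Finset ℕ) : tri T S ⊆ T := by
  fun_induction tri T S with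
  | case1 T S hS hT ih =>
    intro a ha
    rw [Finset.mem_insert] at ha
    rcases ha with rfl | ha
    · exact (Finset.mem_filter.1 (Finset.max'_mem _ hT)).1
    · exact (Finset.mem_filter.1 (ih ha)).1
  | case2 => simp
  | case3 => simp

theorem up_tri_le (T S : Finset ℕ) (w : ℕ) : up (tri T S) w ≤ up S (w + 1) := by
  fun_induction tri T S with
  | case1 T S hS hT ih =>
    have hm := (Finset.mem_filter.1 (Finset.max'_mem _ hT)).2
    have h1 := up_erase S _ (w + 1) (S.max'_mem hS)
    refine (up_insert_le _ _ _).trans ?_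
    rw [h1]
    split_ifs <;> omega
  | case2 => simp [up]
  | case3 => simp [up]

theorem up_tri_bound (T S : Finset ℕ) (y w : ℕ) (h : y ≤ w) :
    up (tri T S) y ≤ up S (w + 1) + seg T y w := by
  have := up_add (tri T S) y w h
  have := up_tri_le T S w
  have := seg_mono (tri_subset T S) y w
  omega

theorem up_tri_attain (T S : Finset ℕ) (y : ℕ) :
    ∃ w, y ≤ w ∧ up S (w + 1) + seg T y w ≤ up (tri T S) y := by
  fun_induction tri T S with
  | case1 T S hS hT ih =>
    obtain ⟨w, hw, hle⟩ := ih
    have hm := Finset.mem_filter.1 (Finset.max'_mem _ hT)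
    have hmax : ∀ t ∈ T, t < S.max' hS → t ≤ (T.filter (fun t => t < S.max' hS)).max' hT :=
      fun t ht h => Finset.le_max' _ _ (Finset.mem_filter.2 ⟨ht, h⟩)
    have hsm : ∀ a ∈ S, a ≤ S.max' hS := fun a ha => Finset.le_max' _ _ ha
    have hs := S.max'_mem hS
    generalize (T.filter (fun t => t < S.max' hS)).max' hT = m at *
    generalize S.max' hS = s at *
    by_cases hy : m < y
    · refine ⟨max y s, le_max_left _ _, ?_⟩
      rw [up_eq_zero S _ (fun a ha => by have := hsm a ha; omega), seg_eq_zero]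
      · omega
      · intro a ha h1 h2
        have := hmax a ha (by omega)
        omega
    · have hD : up (insert m (tri (T.filter (fun t => t < m)) (S.erase s))) y
          = up (tri (T.filter (fun t => t < m)) (S.erase s)) y + 1 := by
        unfold up; rw [Finset.filter_insert, if_pos (by omega), Finset.card_insert_of_notMem]
        intro h
        have := tri_subset _ _ (Finset.mem_filter.1 h).1
        simp at this
      rw [hD]
      by_cases hwm : w ≤ m
      · refine ⟨w, hw, ?_⟩
        have h1 := up_erase S s (w + 1) hs
        rw [if_pos (by omega)] at h1
        have h2 : seg T y w = seg (T.filter (fun t => t < m)) y w := by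
          unfold seg; congr 1; ext a; simp only [Finset.mem_filter]
          constructor
          · rintro ⟨a1, a2, a3⟩; exact ⟨⟨a1, by omega⟩, a2, a3⟩
          · rintro ⟨⟨a1, _⟩, a2, a3⟩; exact ⟨a1, a2, a3⟩
        omega
      · refine ⟨s, by omega, ?_⟩
        rw [up_eq_zero S _ (fun a ha => by have := hsm a ha; omega)]
        have h2 : seg T y s ≤ seg (T.filter (fun t => t < m)) y w + 1 := by
          unfold seg
          refine le_trans (Finset.card_le_card ?_) (Finset.card_insert_le m _)
          intro a ha
          simp only [Finset.mem_filter, Finset.mem_insert] at ha ⊢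
          have := hmax a ha.1 ha.2.2
          by_cases a = m
          · left; assumption
          · right; exact ⟨⟨ha.1, by omega⟩, ha.2.1, by omega⟩
        omega
  | case2 T S hS hT =>
    have hsm : ∀ a ∈ S, a ≤ S.max' hS := fun a ha => Finset.le_max' _ _ ha
    refine ⟨max y (S.max' hS), le_max_left _ _, ?_⟩
    rw [up_eq_zero S _ (fun a ha => by have := hsm a ha; omega), seg_eq_zero]
    · omega
    · intro a ha h1 h2
      exact hT ⟨a, Finset.mem_filter.2 ⟨ha, by omega⟩⟩
  | case3 T S hS =>
    rw [Finset.not_nonempty_iff_eq_empty] at hS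
    subst hS
    exact ⟨y, le_rfl, by rw [seg_eq_zero _ _ _ (fun a _ h1 h2 => by omega)]; simp [up]⟩

theorem card_lt_eq_seg (A : Finset ℕ) (x : ℕ) : (A.filter (· < x)).card = seg A 0 x := by
  unfold seg; simp

theorem seg_le_of (T U : Finset ℕ) (x : ℕ)
    (hc : (U.filter (· < x)).card ≤ (T.filter (· < x)).card)
    (h : ∀ i, 1 ≤ i → i ≤ (U.filter (· < x)).card →
      nth U i < nth T (i + ((T.filter (· < x)).card - (U.filter (· < x)).card)))
    (w : ℕ) (hw : w < x) : seg U w x ≤ seg T (w + 1) x := by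
  have hTc : (T.filter (· < x)).card ≤ T.card := Finset.card_filter_le _ _
  have hUc : (U.filter (· < x)).card ≤ U.card := Finset.card_filter_le _ _
  rw [card_lt_eq_seg] at *
  rw [card_lt_eq_seg] at *
  have hU := seg_add U 0 w x (by omega) (by omega)
  have hT := seg_add T 0 (w + 1) x (by omega) (by omega)
  by_cases hk : seg U w x = 0
  · omega
  have h0 := h (seg U 0 w + 1) (by omega) (by omega)
  obtain ⟨u1, u2⟩ := nth_spec_s15 U (seg U 0 w + 1) (by omega) (by omega)
  obtain ⟨t1, t2⟩ := nth_spec_s15 T (seg U 0 w + 1 + (seg T 0 x - seg U 0 x)) (by omega) (by omega)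
  generalize nth U (seg U 0 w + 1) = u at *
  generalize nth T (seg U 0 w + 1 + (seg T 0 x - seg U 0 x)) = t at *
  rw [card_lt_eq_seg] at u2 t2
  have hwu : w ≤ u := by
    by_contra hlt
    have a1 := seg_add U 0 u w (by omega) (by omega)
    have : 0 < seg U u w := Finset.card_pos.2 ⟨u, by simp [u1]; omega⟩
    omega
  have a2 := seg_add T 0 (w + 1) t (by omega) (by omega)
  omega

theorem stmt15 (T U : Finset ℕ) (hTpos : ∀ a ∈ T, 0 < a) (hUpos : ∀ a ∈ U, 0 < a)
    (x : ℕ) (hx : 0 < x) (hxT : x ∉ T)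
    (hd : Dom (U.filter (fun u => x ≤ u)) (T.filter (fun t => x < t)))
    (hc : (U.filter (· < x)).card ≤ (T.filter (· < x)).card)
    (h : ∀ i, 1 ≤ i → i ≤ (U.filter (· < x)).card →
      nth U i < nth T (i + ((T.filter (· < x)).card - (U.filter (· < x)).card))) :
    ∀ S : Finset ℕ, (∀ a ∈ S, 0 < a) →
      tri U (tri T S) = tri U (tri (insert x T) S) := by
  intro S _
  apply eq_of_up
  intro y
  have hsub : T ⊆ insert x T := Finset.subset_insert _ _
  apply le_antisymm
  · obtain ⟨w, hw, h1⟩ := up_tri_attain U (tri (insert x T) S) y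
    obtain ⟨v, hv, h2⟩ := up_tri_attain (insert x T) S (w + 1)
    have b1 := up_tri_bound U (tri T S) y w hw
    have b2 := up_tri_bound T S (w + 1) v hv
    have b3 := seg_mono hsub (w + 1) v
    omega
  · obtain ⟨w, hw, h1⟩ := up_tri_attain U (tri T S) y
    obtain ⟨v, hv, h2⟩ := up_tri_attain T S (w + 1)
    by_cases hcase : x < w + 1 ∨ v ≤ x
    · have b1 := up_tri_bound U (tri (insert x T) S) y w hw
      have b2 := up_tri_bound (insert x T) S (w + 1) v hv
      have b3 := seg_insert_of T x (w + 1) v hcase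
      omega
    · have b1 := up_tri_bound U (tri (insert x T) S) y x (by omega)
      have b2 := up_tri_bound (insert x T) S (x + 1) v (by omega)
      have b3 := seg_insert_of T x (x + 1) v (by omega)
      have b4 := seg_le_of T U x hc h w (by omega)
      have b5 := seg_add U y w x hw (by omega)
      have b6 := seg_add T (w + 1) x v (by omega) (by omega)
      have b7 := seg_add T x (x + 1) v (by omega) (by omega)
      omega
end
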